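/- Let Γ be a simple graph with finite vertex set V, and let θ : W_{ΔΓ} → (ℤ/2ℤ)^V be the homomorphism determined on generators by θ(s) = e_s and θ(s') = e_s for s ∈ V. Then the homomorphism β : A_Γ → W_{ΔΓ} determined on generators by β(s) = s s' is well-defined and injective, and its range is exactly the kernel of θ; in particular the right-angled Artin group A_Γ is isomorphic to ker(θ), a normal subgroup of W_{ΔΓ} of index 2^{|V|}. -/

import Mathlib

/-- Relations of the right-angled Artin group: commutators of adjacent generators. -/
def raagRels {V : Type} (Γ : SimpleGraph V) : Set (FreeGroup V) :=
  {r | ∃ s t : V, Γ.Adj s t ∧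
    r = FreeGroup.of s * FreeGroup.of t * (FreeGroup.of s)⁻¹ * (FreeGroup.of t)⁻¹}

/-- The right-angled Artin group of a simple graph. -/
abbrev RAAG {V : Type} (Γ : SimpleGraph V) : Type := PresentedGroup (raagRels Γ)

/-- Relations of the right-angled Coxeter group: squares of the generators and
commutators of adjacent generators. -/
def racgRels {V : Type} (Γ : SimpleGraph V) : Set (FreeGroup V) :=
  {r | ∃ s : V, r = FreeGroup.of s * FreeGroup.of s} ∪
  {r | ∃ s t : V, Γ.Adj s t ∧
    r = FreeGroup.of s * FreeGroup.of t * (FreeGroup.of s)⁻¹ * (FreeGroup.of t)⁻¹}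

/-- The right-angled Coxeter group of a simple graph. -/
abbrev RACG {V : Type} (Γ : SimpleGraph V) : Type := PresentedGroup (racgRels Γ)

/-- The graph `ΔΓ` on `V ⊔ V'`: edges `{s,t}` for each edge of `Γ`, `{s',t'}` for
all distinct `s,t`, and `{s,t'}` for all distinct `s,t`. -/
def deltaGraph {V : Type} (Γ : SimpleGraph V) : SimpleGraph (V ⊕ V) :=
  SimpleGraph.fromRel fun x y =>
    match x, y with
    | .inl s, .inl t => Γ.Adj s t
    | .inl s, .inr t => s ≠ t
    | .inr _, .inr _ => True
    | .inr _, .inl _ => False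

theorem deltaGraph_adj_inl_inl {V : Type} (Γ : SimpleGraph V) {s t : V} :
    (deltaGraph Γ).Adj (.inl s) (.inl t) ↔ Γ.Adj s t := by
  simp only [deltaGraph, SimpleGraph.fromRel_adj, Γ.adj_comm t s, or_self, ne_eq,
    Sum.inl.injEq, and_iff_right_iff_imp]
  exact fun h => h.ne

theorem deltaGraph_adj_inl_inr {V : Type} (Γ : SimpleGraph V) {s t : V} :
    (deltaGraph Γ).Adj (.inl s) (.inr t) ↔ s ≠ t := by
  simp [deltaGraph]

theorem deltaGraph_adj_inr_inr {V : Type} (Γ : SimpleGraph V) {s t : V} :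
    (deltaGraph Γ).Adj (.inr s) (.inr t) ↔ s ≠ t := by
  simp [deltaGraph]

namespace RAAG

variable {V : Type} {Γ : SimpleGraph V} {G : Type} [Group G]

theorem of_commute {s t : V} (h : Γ.Adj s t) :
    Commute (PresentedGroup.of s : RAAG Γ) (PresentedGroup.of t) := by
  have := PresentedGroup.one_of_mem (rels := raagRels Γ) ⟨s, t, h, rfl⟩
  simp only [map_mul, map_inv] at this
  exact mul_inv_eq_iff_eq_mul.mp (mul_inv_eq_one.mp this)

/-- The universal property of a right-angled Artin group. -/
def lift (f : V → G) (hf : ∀ s t, Γ.Adj s t → Commute (f s) (f t)) :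
    RAAG Γ →* G :=
  PresentedGroup.toGroup (f := f) <| by
    rintro _ ⟨s, t, h, rfl⟩
    simp [(hf s t h).eq]

@[simp]
theorem lift_of (f : V → G) (hf : ∀ s t, Γ.Adj s t → Commute (f s) (f t)) (s : V) :
    lift f hf (PresentedGroup.of s) = f s :=
  PresentedGroup.toGroup.of _

/-- The endomorphism inverting the generator `s` and fixing the others. -/
def invertHom [DecidableEq V] (Γ : SimpleGraph V) (s : V) : RAAG Γ →* RAAG Γ :=
  lift (fun t => if t = s then (PresentedGroup.of t)⁻¹ else PresentedGroup.of t) <| by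
    intro a b h
    have := of_commute h
    split_ifs <;> simpa using this

theorem invertHom_of [DecidableEq V] (s t : V) :
    invertHom Γ s (PresentedGroup.of t) =
      if t = s then (PresentedGroup.of t)⁻¹ else PresentedGroup.of t :=
  lift_of _ _ t

theorem invertHom_comp_self [DecidableEq V] (s : V) :
    (invertHom Γ s).comp (invertHom Γ s) = MonoidHom.id _ := by
  refine PresentedGroup.ext fun t => ?_
  by_cases h : t = s <;> simp [invertHom_of, h]

theorem invertHom_comp_comm [DecidableEq V] (s t : V) :
    (invertHom Γ s).comp (invertHom Γ t) = (invertHom Γ t).comp (invertHom Γ s) := by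
  refine PresentedGroup.ext fun u => ?_
  by_cases h : u = s <;> by_cases h' : u = t <;> grind [invertHom_of, MonoidHom.comp_apply]

/-- The automorphism inverting the generator `s` and fixing the others. -/
def invert [DecidableEq V] (Γ : SimpleGraph V) (s : V) : MulAut (RAAG Γ) :=
  (invertHom Γ s).toMulEquiv (invertHom Γ s) (invertHom_comp_self s) (invertHom_comp_self s)

theorem invert_of [DecidableEq V] (s t : V) :
    invert Γ s (PresentedGroup.of t) =
      if t = s then (PresentedGroup.of t)⁻¹ else PresentedGroup.of t :=
  invertHom_of s t

theorem invert_mul_self [DecidableEq V] (s : V) : invert Γ s * invert Γ s = 1 :=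
  MulEquiv.ext fun x => DFunLike.congr_fun (invertHom_comp_self s) x

theorem invert_commute [DecidableEq V] (s t : V) : Commute (invert Γ s) (invert Γ t) :=
  MulEquiv.ext fun x => DFunLike.congr_fun (invertHom_comp_comm s t) x

end RAAG

namespace RACG

variable {V : Type} {Γ : SimpleGraph V} {G : Type} [Group G]

theorem of_mul_self (s : V) :
    (PresentedGroup.of s : RACG Γ) * PresentedGroup.of s = 1 := by
  have := PresentedGroup.one_of_mem (rels := racgRels Γ) (Or.inl ⟨s, rfl⟩)
  rwa [map_mul] at this

theorem of_commute {s t : V} (h : Γ.Adj s t) :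
    Commute (PresentedGroup.of s : RACG Γ) (PresentedGroup.of t) := by
  have := PresentedGroup.one_of_mem (rels := racgRels Γ) (Or.inr ⟨s, t, h, rfl⟩)
  simp only [map_mul, map_inv] at this
  exact mul_inv_eq_iff_eq_mul.mp (mul_inv_eq_one.mp this)

/-- The universal property of a right-angled Coxeter group. -/
def lift (f : V → G) (hsq : ∀ s, f s * f s = 1)
    (hf : ∀ s t, Γ.Adj s t → Commute (f s) (f t)) : RACG Γ →* G :=
  PresentedGroup.toGroup (f := f) <| by
    rintro _ (⟨s, rfl⟩ | ⟨s, t, h, rfl⟩)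
    · simpa using hsq s
    · simp [(hf s t h).eq]

@[simp]
theorem lift_of (f : V → G) (hsq : ∀ s, f s * f s = 1)
    (hf : ∀ s t, Γ.Adj s t → Commute (f s) (f t)) (s : V) :
    lift f hsq hf (PresentedGroup.of s) = f s :=
  PresentedGroup.toGroup.of _

end RACG

section ElementaryAbelian

variable {V : Type} [Fintype V] [DecidableEq V] {G : Type} [Group G]

theorem closure_range_ofAdd_single :
    Subgroup.closure (Set.range fun s : V =>
      Multiplicative.ofAdd (Pi.single s 1 : V → ZMod 2)) = ⊤ := by
  refine eq_top_iff.mpr fun v _ => ?_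
  have hv : v = ∏ s, Multiplicative.ofAdd (Pi.single s (v.toAdd s) : V → ZMod 2) := by
    rw [← ofAdd_sum, Finset.univ_sum_single, ofAdd_toAdd]
  rw [hv]
  refine Subgroup.prod_mem _ fun s _ => ?_
  obtain h | h : v.toAdd s = 0 ∨ v.toAdd s = 1 := by
    generalize v.toAdd s = x
    revert x
    decide
  · simp [h, one_mem]
  · rw [h]
    exact Subgroup.subset_closure ⟨s, rfl⟩

/-- Pairwise commuting involutions indexed by `V` define a homomorphism from `(ℤ/2ℤ)^V`. -/
theorem exists_monoidHom_ofAdd_single (f : V → G) (hsq : ∀ s, f s * f s = 1)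
    (hf : ∀ s t, Commute (f s) (f t)) :
    ∃ j : Multiplicative (V → ZMod 2) →* G,
      ∀ s, j (Multiplicative.ofAdd (Pi.single s 1)) = f s := by
  have hpow : ∀ s, ∀ x y : ZMod 2, f s ^ (x + y).val = f s ^ x.val * f s ^ y.val := by
    intro s x y
    rw [← pow_add, ZMod.val_add]
    exact (pow_eq_pow_mod _ (by rw [pow_two, hsq])).symm
  let g : ∀ _ : V, Multiplicative (ZMod 2) →* G := fun s =>
    { toFun := fun x => f s ^ x.toAdd.val
      map_one' := by simp
      map_mul' := fun x y => hpow s x.toAdd y.toAdd }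
  have hg : Pairwise fun s t => ∀ x y, Commute (g s x) (g t y) :=
    fun s t _ x y => (hf s t).pow_pow _ _
  refine ⟨(MonoidHom.noncommPiCoprod g hg).comp
    (MulEquiv.piMultiplicative fun _ : V => ZMod 2).toMonoidHom, fun s => ?_⟩
  have : MulEquiv.piMultiplicative (fun _ : V => ZMod 2)
      (Multiplicative.ofAdd (Pi.single s 1)) =
      Pi.mulSingle s (Multiplicative.ofAdd (1 : ZMod 2)) := by
    ext t
    by_cases h : t = s
    · subst h; simp
    · simp [h]
  change MonoidHom.noncommPiCoprod g hg
    (MulEquiv.piMultiplicative _ (Multiplicative.ofAdd (Pi.single s 1))) = _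
  rw [this, MonoidHom.noncommPiCoprod_mulSingle]
  simp [g, ZMod.val_one]

end ElementaryAbelian

/-- the map `s ↦ s s'` gives a well-defined injective homomorphism
`β : A_Γ → W_{ΔΓ}` whose range is exactly `ker θ`, where `θ(s) = θ(s') = e_s`;
hence `A_Γ` is isomorphic to `ker θ`, a normal subgroup of index `2^|V|`. -/
theorem raag_iso_ker_theta {V : Type} [Fintype V] [DecidableEq V]
    (Γ : SimpleGraph V)
    (θ : RACG (deltaGraph Γ) →* Multiplicative (V → ZMod 2))
    (hθ : ∀ s : V,
      θ (PresentedGroup.of (Sum.inl s)) = Multiplicative.ofAdd (Pi.single s 1) ∧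
      θ (PresentedGroup.of (Sum.inr s)) = Multiplicative.ofAdd (Pi.single s 1)) :
    ∃ β : RAAG Γ →* RACG (deltaGraph Γ),
      (∀ s : V, β (PresentedGroup.of s) =
        PresentedGroup.of (Sum.inl s) * PresentedGroup.of (Sum.inr s)) ∧
      Function.Injective β ∧
      β.range = MonoidHom.ker θ ∧
      (MonoidHom.ker θ).Normal ∧
      (MonoidHom.ker θ).index = 2 ^ Fintype.card V := by
  obtain ⟨α, hα⟩ := exists_monoidHom_ofAdd_single (RAAG.invert Γ) RAAG.invert_mul_self
    RAAG.invert_commute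
  obtain ⟨j, hj⟩ := exists_monoidHom_ofAdd_single
    (fun s : V => (PresentedGroup.of (.inr s) : RACG (deltaGraph Γ)))
    (fun s => RACG.of_mul_self _) fun s t => by
      obtain rfl | h := eq_or_ne s t
      · exact Commute.refl _
      · exact RACG.of_commute ((deltaGraph_adj_inr_inr Γ).mpr h)
  have hlr : ∀ s t : V, Commute
      (PresentedGroup.of (.inl s) : RACG (deltaGraph Γ)) (PresentedGroup.of (.inr t)) ∨ s = t :=
    fun s t => (eq_or_ne s t).symm.imp_left fun h =>
      RACG.of_commute ((deltaGraph_adj_inl_inr Γ).mpr h)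
  let β : RAAG Γ →* RACG (deltaGraph Γ) := RAAG.lift
    (fun s => PresentedGroup.of (Sum.inl s) * PresentedGroup.of (Sum.inr s)) <| by
      intro s t h
      have hll := RACG.of_commute ((deltaGraph_adj_inl_inl Γ).mpr h)
      have hrr := RACG.of_commute ((deltaGraph_adj_inr_inr Γ).mpr h.ne)
      have hst := (hlr s t).resolve_right h.ne
      have hts := (hlr t s).resolve_right h.ne'
      exact (hll.mul_right hst).mul_left (hts.symm.mul_right hrr)
  have hβ : ∀ s, β (PresentedGroup.of s) =
      PresentedGroup.of (Sum.inl s) * PresentedGroup.of (Sum.inr s) := RAAG.lift_of _ _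
  let e : V → Multiplicative (V → ZMod 2) := fun s => Multiplicative.ofAdd (Pi.single s 1)
  have he : ∀ s, e s * e s = 1 := fun s => by
    change Multiplicative.ofAdd (Pi.single s 1 + Pi.single s 1 : V → ZMod 2) = 1
    rw [← Pi.single_add, show (1 + 1 : ZMod 2) = 0 from rfl, Pi.single_zero, ofAdd_zero]
  have hαe : ∀ s, α (e s) = RAAG.invert Γ s := hα
  let f : V ⊕ V → RAAG Γ ⋊[α] Multiplicative (V → ZMod 2) :=
    Sum.elim (fun s => ⟨PresentedGroup.of s, e s⟩) (fun s => ⟨1, e s⟩)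
  let φ : RACG (deltaGraph Γ) →* RAAG Γ ⋊[α] Multiplicative (V → ZMod 2) := RACG.lift f
    (by
      rintro (s | s) <;> ext <;> simp [f, he, hαe, RAAG.invert_of])
    (by
      have hmix : ∀ s t, s ≠ t → Commute (f (.inl s)) (f (.inr t)) := fun s t h => by
        ext <;> simp [f, hαe, RAAG.invert_of, h, mul_comm]
      rintro (s | s) (t | t) h
      · rw [deltaGraph_adj_inl_inl] at h
        have := (RAAG.of_commute h).eq
        ext <;> simp [f, hαe, RAAG.invert_of, h.ne, h.ne', mul_comm, this]
      · exact hmix s t ((deltaGraph_adj_inl_inr Γ).mp h)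
      · exact (hmix t s ((deltaGraph_adj_inl_inr Γ).mp h.symm)).symm
      · ext <;> simp [f, mul_comm])
  have hφ : ∀ x, φ (PresentedGroup.of x) = f x := RACG.lift_of _ _ _
  have hφβ : φ.comp β = SemidirectProduct.inl := by
    refine PresentedGroup.ext fun s => ?_
    rw [MonoidHom.comp_apply, hβ, map_mul, hφ, hφ]
    ext <;> simp [f, he]
  have hθφ : SemidirectProduct.rightHom.comp φ = θ := by
    refine PresentedGroup.ext fun x => ?_
    rw [MonoidHom.comp_apply, hφ]
    rcases x with s | s
    · exact (hθ s).1.symm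
    · exact (hθ s).2.symm
  have hθj : θ.comp j = MonoidHom.id _ := by
    refine MonoidHom.eq_of_eqOn_dense closure_range_ofAdd_single ?_
    rintro _ ⟨s, rfl⟩
    simp [hj, hθ]
  have hconj : ∀ v, β.comp (α v).toMonoidHom = (MulAut.conj (j v)).toMonoidHom.comp β := by
    intro v
    have hv : v ∈ Subgroup.closure (Set.range e) := by
      rw [closure_range_ofAdd_single]
      trivial
    have hgen : ∀ s x, β (α (e s) x) = j (e s) * β x * (j (e s))⁻¹ := by
      intro s
      suffices β.comp (α (e s)).toMonoidHom = (MulAut.conj (j (e s))).toMonoidHom.comp β from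
        DFunLike.congr_fun this
      refine PresentedGroup.ext fun t => ?_
      have hl := RACG.of_mul_self (Γ := deltaGraph Γ) (.inl t)
      have hr := RACG.of_mul_self (Γ := deltaGraph Γ) (.inr t)
      have hje : j (e s) = PresentedGroup.of (.inr s) := hj s
      simp only [MonoidHom.comp_apply, MulEquiv.coe_toMonoidHom, MulAut.conj_apply, hαe,
        RAAG.invert_of, hje]
      obtain rfl | h := eq_or_ne t s
      · rw [if_pos rfl, map_inv, hβ, mul_inv_rev, ← mul_assoc, mul_inv_cancel_right,
          inv_eq_of_mul_eq_one_left hl, inv_eq_of_mul_eq_one_left hr]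
      · have hc : Commute (PresentedGroup.of (.inr s) : RACG (deltaGraph Γ))
            (β (PresentedGroup.of t)) := by
          rw [hβ]
          exact ((hlr t s).resolve_right h).symm.mul_right
            (RACG.of_commute ((deltaGraph_adj_inr_inr Γ).mpr h.symm))
        rw [if_neg h, hc.eq, mul_inv_cancel_right]
    suffices ∀ x, β (α v x) = j v * β x * (j v)⁻¹ from MonoidHom.ext this
    induction hv using Subgroup.closure_induction with
    | mem v hv => obtain ⟨s, rfl⟩ := hv; exact hgen s
    | one => simp
    | mul v w _ _ hv hw => intro x; simp [hv, hw, mul_assoc]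
    | inv v _ hv =>
      intro x
      have := hv (α v⁻¹ x)
      rw [← MulAut.mul_apply, ← map_mul, mul_inv_cancel, map_one, MulAut.one_apply] at this
      rw [this]
      simp [mul_assoc]
  let ψ := SemidirectProduct.lift β j hconj
  have hψφ : ψ.comp φ = MonoidHom.id _ := by
    refine PresentedGroup.ext fun x => ?_
    rw [MonoidHom.comp_apply, hφ]
    rcases x with s | s
    · change β (PresentedGroup.of s) * j (e s) = _
      rw [hβ, hj, mul_assoc, RACG.of_mul_self, mul_one]
      rfl
    · change β 1 * j (e s) = _
      rw [map_one, one_mul, hj]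
      rfl
  refine ⟨β, hβ, ?_, ?_, inferInstance, ?_⟩
  · refine Function.Injective.of_comp (f := φ) ?_
    rw [← MonoidHom.coe_comp, hφβ]
    exact SemidirectProduct.inl_injective
  · refine le_antisymm ?_ fun w hw => ?_
    · rintro _ ⟨a, rfl⟩
      rw [MonoidHom.mem_ker, ← hθφ, MonoidHom.comp_apply, ← MonoidHom.comp_apply φ, hφβ]
      simp
    · have hr : (φ w).right = 1 := by
        rw [MonoidHom.mem_ker, ← hθφ] at hw
        exact hw
      have hw' : β (φ w).left * j (φ w).right = w := DFunLike.congr_fun hψφ w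
      rw [hr, map_one, mul_one] at hw'
      exact ⟨_, hw'⟩
  · have hsurj : Function.Surjective θ := fun v => ⟨j v, DFunLike.congr_fun hθj v⟩
    rw [Subgroup.index_ker, MonoidHom.range_eq_top.mpr hsurj]
    simp [Nat.card_eq_fintype_card]
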